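/- Let μ be a probability measure on ℝ which is absolutely continuous with density ρ supported on a bounded interval (a,b), and suppose m := inf_{x∈(a,b)} ρ(x) > 0. Let φ(θ) = q(|θ|/π) for θ ∈ (−π,π), extended 2π-periodically, where q is the quantile function of μ. Then for every θ ∈ (−π,π) the principal-value limit defining the periodic Hilbert transform H{φ}(θ) exists and is finite, and moreover sup_{θ∈(−π,π)} |H{φ}(θ)| < ∞. -/

import Mathlib

open MeasureTheory Filter Set
open scoped Real

/-- The cumulative distribution function of a measure `μ` on `ℝ`: `F(x) = μ((−∞, x])`. -/
noncomputable def cdfFn (μ : Measure ℝ) (x : ℝ) : ℝ := (μ (Iic x)).toReal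

/-- The quantile function of `μ`: `q(u) = inf {x | F(x) ≥ u}`. -/
noncomputable def quantileFn (μ : Measure ℝ) (u : ℝ) : ℝ := sInf {x : ℝ | u ≤ cdfFn μ x}

/-- The truncated integral whose limit as `η → 0⁺` defines the periodic Hilbert
transform of `f` at `x`: `(1/(2π)) ∫_{η ≤ |t| ≤ π} f(x−t) cot(t/2) dt`. -/
noncomputable def pvH (f : ℝ → ℝ) (x η : ℝ) : ℝ :=
  (1 / (2 * π)) *
    ∫ t in {t : ℝ | η ≤ |t| ∧ |t| ≤ π}, f (x - t) * (Real.cos (t / 2) / Real.sin (t / 2))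

open Real (pi_pos)

/-- A density bounded below by `m` on `(a, b)` makes the distribution function grow at rate at
least `m` on `[a, b]`. -/
lemma cdfFn_add_mul_le {μ : Measure ℝ} [IsFiniteMeasure μ] {ρ : ℝ → ℝ} {a b m : ℝ}
    (hdens : μ = volume.withDensity (fun x => ENNReal.ofReal (ρ x)))
    (hm : 0 ≤ m) (hρ : ∀ x ∈ Ioo a b, m ≤ ρ x) {x y : ℝ} (hax : a ≤ x) (hxy : x ≤ y)
    (hyb : y ≤ b) : cdfFn μ x + m * (y - x) ≤ cdfFn μ y := by
  have h1 : ENNReal.ofReal (m * (y - x)) ≤ μ (Ioo x y) := by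
    rw [hdens, withDensity_apply _ measurableSet_Ioo, ENNReal.ofReal_mul hm, ← Real.volume_Ioo,
      ← setLIntegral_const]
    exact setLIntegral_mono' measurableSet_Ioo fun z hz =>
      ENNReal.ofReal_le_ofReal (hρ z ⟨hax.trans_lt hz.1, hz.2.trans_le hyb⟩)
  have h2 : m * (y - x) ≤ (μ (Ioo x y)).toReal :=
    (ENNReal.ofReal_le_iff_le_toReal (measure_ne_top _ _)).1 h1
  have h3 : μ (Iic x) + μ (Ioo x y) ≤ μ (Iic y) := by
    rw [← measure_union _ measurableSet_Ioo]
    · refine measure_mono ?_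
      rintro z (hz | hz)
      · exact le_trans hz hxy
      · exact hz.2.le
    · exact Set.disjoint_left.2 fun z hz hz' => not_lt.2 hz hz'.1
  have h4 := ENNReal.toReal_mono (measure_ne_top _ _) h3
  rw [ENNReal.toReal_add (measure_ne_top _ _) (measure_ne_top _ _)] at h4
  unfold cdfFn
  linarith

lemma measure_eq_zero_of_density_eq_zero {μ : Measure ℝ} {ρ : ℝ → ℝ}
    (hdens : μ = volume.withDensity (fun x => ENNReal.ofReal (ρ x))) {s : Set ℝ}
    (hs : MeasurableSet s) (h : ∀ x ∈ s, ρ x = 0) : μ s = 0 := by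
  rw [hdens, withDensity_apply _ hs, setLIntegral_congr_fun (g := fun _ => 0) hs]
  · simp
  · intro x hx
    simp [h x hx]

lemma lipschitzOnWith_quantileFn {μ : Measure ℝ} [IsProbabilityMeasure μ] {ρ : ℝ → ℝ} {a b m : ℝ}
    (hdens : μ = volume.withDensity (fun x => ENNReal.ofReal (ρ x)))
    (hsupp : ∀ x, x ∉ Ioo a b → ρ x = 0)
    (hm : 0 < m) (hρ : ∀ x ∈ Ioo a b, m ≤ ρ x) :
    LipschitzOnWith (Real.toNNReal m⁻¹) (quantileFn μ) (Ioo 0 1) := by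
  have hleft : ∀ x ≤ a, cdfFn μ x = 0 := fun x hx => by
    rw [cdfFn, measure_eq_zero_of_density_eq_zero hdens measurableSet_Iic, ENNReal.toReal_zero]
    exact fun z hz => hsupp z fun h => not_lt.2 (le_trans hz hx) h.1
  have hright : ∀ y, b ≤ y → cdfFn μ y = 1 := fun y hy => by
    have h0 : μ (Iic y)ᶜ = 0 :=
      measure_eq_zero_of_density_eq_zero hdens measurableSet_Iic.compl fun z hz =>
        hsupp z fun h => hz (h.2.le.trans hy)
    rw [cdfFn, (prob_compl_eq_zero_iff measurableSet_Iic).1 h0, ENNReal.toReal_one]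
  have hbdd : ∀ u : ℝ, 0 < u → BddBelow {x : ℝ | u ≤ cdfFn μ x} := fun u hu =>
    ⟨a, fun x hx => le_of_not_ge fun h => by
      have : u ≤ cdfFn μ x := hx
      rw [hleft x h] at this
      linarith⟩
  have hne : ∀ u : ℝ, u < 1 → {x : ℝ | u ≤ cdfFn μ x}.Nonempty := fun u hu =>
    ⟨b, by rw [mem_ofPred_eq, hright b le_rfl]; exact hu.le⟩
  have hmono : ∀ u ∈ Ioo (0 : ℝ) 1, ∀ v ∈ Ioo (0 : ℝ) 1, u ≤ v →
      quantileFn μ u ≤ quantileFn μ v := fun u hu v hv huv =>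
    csInf_le_csInf (hbdd u hu.1) (hne v hv.2) fun x hx => huv.trans hx
  have hinc : ∀ u ∈ Ioo (0 : ℝ) 1, ∀ v ∈ Ioo (0 : ℝ) 1, u ≤ v →
      quantileFn μ v ≤ quantileFn μ u + m⁻¹ * (v - u) := fun u hu v hv huv => by
    rw [← sub_le_iff_le_add]
    refine le_csInf (hne u hu.2) fun x hx => ?_
    rw [sub_le_iff_le_add]
    refine csInf_le (hbdd v hv.1) ?_
    have hx' : u ≤ cdfFn μ x := hx
    have hax : a ≤ x := le_of_not_ge fun h => by
      rw [hleft x h] at hx'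
      linarith [hu.1]
    rw [mem_ofPred_eq]
    rcases le_total (x + m⁻¹ * (v - u)) b with h | h
    · have h1 := cdfFn_add_mul_le hdens hm.le hρ hax
        (le_add_of_nonneg_right (mul_nonneg (inv_nonneg.2 hm.le) (sub_nonneg.2 huv))) h
      rw [add_sub_cancel_left, mul_inv_cancel_left₀ hm.ne'] at h1
      linarith
    · rw [hright _ h]
      exact hv.2.le
  refine LipschitzOnWith.of_le_add_mul _ fun u hu v hv => ?_
  rw [Real.coe_toNNReal _ (inv_nonneg.2 hm.le), Real.dist_eq]
  rcases le_total u v with h | h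
  · exact (hmono u hu v hv h).trans
      (le_add_of_nonneg_right (mul_nonneg (inv_nonneg.2 hm.le) (abs_nonneg _)))
  · rw [abs_of_nonneg (sub_nonneg.2 h)]
    exact hinc v hv u hu h

/-- A `2π`-periodic function equal to `q(|θ|/π)` on `(-π, π)`, with `q` Lipschitz on `(0, 1)`,
agrees with a Lipschitz function outside `πℤ`. -/
lemma exists_lipschitzWith_eq_off_int_mul_pi {q φ : ℝ → ℝ} {K : NNReal}
    (hq : LipschitzOnWith K q (Ioo 0 1)) (hper : Function.Periodic φ (2 * π))
    (hφ : ∀ θ ∈ Ioo (-π) π, φ θ = q (|θ| / π)) :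
    ∃ (K' : NNReal) (ψ : ℝ → ℝ), LipschitzWith K' ψ ∧
      ∀ t, t ∉ range (fun k : ℤ => (k : ℝ) * π) → φ t = ψ t := by
  obtain ⟨g, hg, hgq⟩ := hq.extend_real
  have hnorm : LipschitzWith 1 (fun t : ℝ => ‖(t : AddCircle (2 * π))‖) := by
    refine LipschitzWith.of_dist_le_mul fun s t => ?_
    rw [NNReal.coe_one, one_mul, Real.dist_eq, Real.dist_eq]
    refine (abs_norm_sub_norm_le _ _).trans ?_
    rw [← AddCircle.coe_sub]
    exact QuotientAddGroup.norm_mk_le_norm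
  have hdiv : LipschitzWith (Real.toNNReal π⁻¹) (fun t : ℝ => t / π) := by
    refine LipschitzWith.of_dist_le_mul fun s t => ?_
    rw [Real.coe_toNNReal _ (inv_nonneg.2 pi_pos.le), Real.dist_eq, Real.dist_eq, ← sub_div,
      abs_div, abs_of_pos pi_pos, div_eq_inv_mul]
  refine ⟨_, _, hg.comp (hdiv.comp hnorm), fun t ht => ?_⟩
  set n : ℤ := round ((2 * π)⁻¹ * t) with hn
  have hnt : ‖(t : AddCircle (2 * π))‖ = |t - n * (2 * π)| := AddCircle.norm_eq _
  have hle : |t - n * (2 * π)| ≤ π := by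
    rw [← hnt]
    have := AddCircle.norm_le_half_period (2 * π) (x := (t : AddCircle (2 * π))) (by positivity)
    rwa [abs_of_pos (by positivity), mul_div_cancel_left₀ _ two_ne_zero] at this
  have hoff : ∀ k : ℤ, t - n * (2 * π) ≠ k * π := fun k hk =>
    ht ⟨k + 2 * n, by push_cast; linarith⟩
  have hpos : 0 < |t - n * (2 * π)| := abs_pos.2 fun h => hoff 0 (by simpa using h)
  have hlt : |t - n * (2 * π)| < π := by
    refine lt_of_le_of_ne hle fun h => ?_
    rcases eq_or_eq_neg_of_abs_eq h with h | h
    · exact hoff 1 (by simpa using h)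
    · exact hoff (-1) (by simpa using h)
  rw [← hper.sub_int_mul_eq n, hφ _ (abs_lt.1 hlt)]
  simp only [Function.comp_apply, hnt]
  exact hgq ⟨by positivity, (div_lt_one pi_pos).2 hlt⟩

lemma pvH_congr_off_countable {φ ψ : ℝ → ℝ} {s : Set ℝ} (hs : s.Countable)
    (h : ∀ t, t ∉ s → φ t = ψ t) (θ η : ℝ) : pvH φ θ η = pvH ψ θ η := by
  have hc : ((fun t => θ - t) ⁻¹' s).Countable := hs.preimage (sub_right_injective)
  unfold pvH
  congr 1
  refine integral_congr_ae (ae_restrict_of_ae ?_)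
  filter_upwards [hc.ae_notMem volume] with t ht
  rw [h _ ht]

/-- The truncated integral folded onto `[η, π]` by the symmetry `t ↦ -t`. -/
lemma pvH_eq_intervalIntegral {ψ : ℝ → ℝ} (hψ : Continuous ψ) (θ : ℝ) {η : ℝ} (hη : 0 < η)
    (hηπ : η ≤ π) :
    pvH ψ θ η = (1 / (2 * π)) *
      ∫ t in η..π, (ψ (θ - t) - ψ (θ + t)) * (Real.cos (t / 2) / Real.sin (t / 2)) := by
  have hset : {t : ℝ | η ≤ |t| ∧ |t| ≤ π} = Icc η π ∪ Icc (-π) (-η) := by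
    ext t
    simp only [mem_ofPred_eq, mem_union, mem_Icc, le_abs, abs_le]
    constructor
    · rintro ⟨h | h, h1, h2⟩
      · exact Or.inl ⟨h, h2⟩
      · exact Or.inr ⟨h1, by linarith⟩
    · rintro (⟨h1, h2⟩ | ⟨h1, h2⟩)
      · exact ⟨Or.inl h1, by linarith, h2⟩
      · exact ⟨Or.inr (by linarith), h1, by linarith⟩
  have hdisj : Disjoint (Icc η π) (Icc (-π) (-η)) :=
    Set.disjoint_left.2 fun t ht ht' => by linarith [ht.1, ht'.2]
  have hsin : ∀ t ∈ Icc η π, Real.sin (t / 2) ≠ 0 := fun t ht =>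
    (Real.sin_pos_of_pos_of_lt_pi (by linarith [ht.1]) (by linarith [ht.2, pi_pos])).ne'
  have hsin' : ∀ t ∈ Icc (-π) (-η), Real.sin (t / 2) ≠ 0 := fun t ht => by
    have := hsin (-t) ⟨by linarith [ht.2], by linarith [ht.1]⟩
    rwa [neg_div, Real.sin_neg, neg_ne_zero] at this
  have hcot : ∀ s : Set ℝ, (∀ t ∈ s, Real.sin (t / 2) ≠ 0) →
      ContinuousOn (fun t => Real.cos (t / 2) / Real.sin (t / 2)) s := fun s hs =>
    ContinuousOn.div (by fun_prop) (by fun_prop) hs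
  have hc1 : ∀ f : ℝ → ℝ, Continuous f → ContinuousOn
      (fun t => f t * (Real.cos (t / 2) / Real.sin (t / 2))) (Icc η π) := fun f hf =>
    hf.continuousOn.mul (hcot _ hsin)
  have hc2 : ContinuousOn
      (fun t => ψ (θ - t) * (Real.cos (t / 2) / Real.sin (t / 2))) (Icc (-π) (-η)) :=
    (hψ.comp (continuous_const.sub continuous_id)).continuousOn.mul (hcot _ hsin')
  have hcm := hc1 (fun t => ψ (θ - t)) (by fun_prop)
  have hcp := hc1 (fun t => ψ (θ + t)) (by fun_prop)
  unfold pvH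
  rw [hset, setIntegral_union hdisj measurableSet_Icc hcm.integrableOn_Icc hc2.integrableOn_Icc,
    integral_Icc_eq_integral_Ioc, integral_Icc_eq_integral_Ioc,
    ← intervalIntegral.integral_of_le hηπ, ← intervalIntegral.integral_of_le (neg_le_neg hηπ),
    ← intervalIntegral.integral_comp_neg]
  congr 1
  rw [← intervalIntegral.integral_add]
  · refine intervalIntegral.integral_congr fun t _ => ?_
    simp only [neg_div, Real.cos_neg, Real.sin_neg, sub_neg_eq_add]
    ring
  · exact hcm.intervalIntegrable_of_Icc hηπ
  · refine (hcp.neg.congr fun t _ => ?_).intervalIntegrable_of_Icc hηπ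
    simp only [neg_div, Real.cos_neg, Real.sin_neg, sub_neg_eq_add, Pi.neg_apply]
    ring

lemma abs_sub_mul_cot_le {ψ : ℝ → ℝ} {K : NNReal} (hψ : LipschitzWith K ψ) (θ : ℝ) {t : ℝ}
    (ht : t ∈ Ioc 0 π) :
    |(ψ (θ - t) - ψ (θ + t)) * (Real.cos (t / 2) / Real.sin (t / 2))| ≤ 2 * K * π := by
  have h1 : |ψ (θ - t) - ψ (θ + t)| ≤ K * (2 * t) := by
    have := hψ.dist_le_mul (θ - t) (θ + t)
    rwa [Real.dist_eq, Real.dist_eq, show θ - t - (θ + t) = -(2 * t) by ring, abs_neg,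
      abs_of_pos (a := 2 * t) (by linarith [ht.1])] at this
  have h2 : t / π ≤ Real.sin (t / 2) := by
    have := Real.mul_le_sin (x := t / 2) (by linarith [ht.1]) (by linarith [ht.2])
    rwa [show 2 / π * (t / 2) = t / π by ring] at this
  have h0 : 0 < t / π := div_pos ht.1 pi_pos
  have h3 : |Real.cos (t / 2) / Real.sin (t / 2)| ≤ 1 / (t / π) := by
    rw [abs_div, abs_of_pos (h0.trans_le h2)]
    exact div_le_div₀ zero_le_one (Real.abs_cos_le_one _) h0 h2
  rw [abs_mul]
  refine (mul_le_mul h1 h3 (abs_nonneg _) (by have := ht.1; positivity)).trans_eq ?_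
  have := ht.1.ne'
  field_simp

/-- The principal value of a Lipschitz function exists, with a bound independent of the point. -/
lemma tendsto_pvH_of_lipschitzWith {ψ : ℝ → ℝ} {K : NNReal} (hψ : LipschitzWith K ψ) :
    ∃ H : ℝ → ℝ, (∀ θ, Tendsto (fun η => pvH ψ θ η) (nhdsWithin 0 (Ioi 0)) (nhds (H θ))) ∧
      ∀ θ, |H θ| ≤ K * π := by
  let G : ℝ → ℝ → ℝ := fun θ t =>
    (ψ (θ - t) - ψ (θ + t)) * (Real.cos (t / 2) / Real.sin (t / 2))
  have hbound : ∀ θ, ∀ t ∈ Ioc 0 π, ‖G θ t‖ ≤ 2 * K * π := fun θ t ht =>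
    abs_sub_mul_cot_le hψ θ ht
  have hψc := hψ.continuous
  have hmeas : ∀ θ, Measurable (G θ) := fun θ => by
    have h1 : Measurable fun t => ψ (θ - t) - ψ (θ + t) :=
      Continuous.measurable (by fun_prop)
    exact h1.mul (by fun_prop)
  have hint : ∀ θ, IntegrableOn (G θ) (Icc 0 π) volume := fun θ => by
    rw [integrableOn_Icc_iff_integrableOn_Ioc]
    refine Measure.integrableOn_of_bounded (M := 2 * K * π) (by simp)
      (hmeas θ).aestronglyMeasurable ?_
    exact (ae_restrict_iff' measurableSet_Ioc).2 (ae_of_all _ (hbound θ))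
  refine ⟨fun θ => (1 / (2 * π)) * ∫ t in (0 : ℝ)..π, G θ t, fun θ => ?_, fun θ => ?_⟩
  · have hcont : ContinuousOn (fun η => ∫ t in η..π, G θ t) (uIcc 0 π) :=
      intervalIntegral.continuousOn_primitive_interval_left
        (by rw [uIcc_of_le pi_pos.le]; exact hint θ)
    have hlim : Tendsto (fun η => ∫ t in η..π, G θ t) (nhdsWithin 0 (Ioi 0))
        (nhds (∫ t in (0 : ℝ)..π, G θ t)) := by
      rw [← nhdsWithin_Ioc_eq_nhdsGT pi_pos]
      exact (hcont 0 left_mem_uIcc).mono_left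
        (nhdsWithin_mono _ (by rw [uIcc_of_le pi_pos.le]; exact Ioc_subset_Icc_self))
    refine (hlim.const_mul (1 / (2 * π))).congr' ?_
    filter_upwards [Ioc_mem_nhdsGT pi_pos] with η hη
    exact (pvH_eq_intervalIntegral hψc θ hη.1 hη.2).symm
  · have h := intervalIntegral.norm_integral_le_of_norm_le_const (a := 0) (b := π) (f := G θ)
      (C := 2 * K * π) (by rw [uIoc_of_le pi_pos.le]; exact hbound θ)
    rw [sub_zero, abs_of_pos pi_pos, Real.norm_eq_abs] at h
    rw [abs_mul, abs_of_pos (by positivity)]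
    refine (mul_le_mul_of_nonneg_left h (by positivity)).trans_eq ?_
    field_simp

/-- If `μ` has a density `ρ` supported on a bounded interval `(a,b)` with
`inf_{(a,b)} ρ > 0`, then the periodic Hilbert transform of `φ(θ) = q(|θ|/π)`
(extended 2π-periodically) exists at every `θ ∈ (−π, π)` and is bounded there. -/
theorem hilbert_transform_of_phi_exists_and_bounded
    (μ : Measure ℝ) [IsProbabilityMeasure μ] (ρ : ℝ → ℝ) (a b : ℝ) (hab : a < b)
    (hdens : μ = volume.withDensity (fun x => ENNReal.ofReal (ρ x)))
    (hsupp : ∀ x, x ∉ Ioo a b → ρ x = 0)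
    (hinf : 0 < ⨅ x : Ioo a b, ρ (x : ℝ))
    (φ : ℝ → ℝ) (hper : Function.Periodic φ (2 * π))
    (hφ : ∀ θ ∈ Ioo (-π) π, φ θ = quantileFn μ (|θ| / π)) :
    ∃ H : ℝ → ℝ,
      (∀ θ ∈ Ioo (-π) π,
        Tendsto (fun η => pvH φ θ η) (nhdsWithin 0 (Ioi 0)) (nhds (H θ))) ∧
      ∃ C : ℝ, ∀ θ ∈ Ioo (-π) π, |H θ| ≤ C := by
  have hρ : ∀ x ∈ Ioo a b, (⨅ x : Ioo a b, ρ (x : ℝ)) ≤ ρ x := fun x hx => by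
    refine ciInf_le (f := fun x : Ioo a b => ρ (x : ℝ)) ?_ ⟨x, hx⟩
    by_contra h
    rw [Real.iInf_of_not_bddBelow h] at hinf
    exact lt_irrefl _ hinf
  obtain ⟨K, ψ, hψ, hφψ⟩ := exists_lipschitzWith_eq_off_int_mul_pi
    (lipschitzOnWith_quantileFn hdens hsupp hinf hρ) hper hφ
  obtain ⟨H, hH, hHb⟩ := tendsto_pvH_of_lipschitzWith hψ
  refine ⟨H, fun θ _ => ?_, K * π, fun θ _ => hHb θ⟩
  simp only [pvH_congr_off_countable (countable_range _) hφψ]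
  exact hH θ
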